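/- There exist absolute constants δ₀ ∈ (0,1) and N₀ such that the following holds. Let δ ∈ (0, δ₀], let L, L', D ≥ 1, let S ⊆ ℤ ∩ [−4D, 4D] be a nonempty finite set which is (L, L', D)-diophantine, and let T ∈ ℕ. Suppose N ≥ N₀, D ≥ (L'/δ)^{8L}, T ≥ (L'/δ)^{8L}, and log(TD)/log N ≤ (δ/L')^{50L}. Let H be any positive integer with H ≤ (δ/L')^{50L}·T·D. Let f : ℕ → ℂ be 1-bounded and suppose 𝔼^log_{n∈[N]} 𝔼_{t,t'∈[T]} 𝔼_{s∈S} f(n+ts)·conj(f(n+t's)) ≥ δ. Then there exists q ∈ ℕ with q ≤ (L'/δ)^{8L} such that ‖f‖_{U¹_log[N;q,H]} ≥ (δ/L')^{25L}. -/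

import Mathlib

noncomputable section

open Finset

/-- `e(x) = exp(2πix)`. -/
def eC (x : ℝ) : ℂ := Complex.exp (2 * Real.pi * Complex.I * x)

/-- Distance to the nearest integer. -/
def dZ (x : ℝ) : ℝ := |x - (round x : ℝ)|

/-- Uniform average of a complex-valued function over a finite set. -/
def avgC {α : Type*} (s : Finset α) (f : α → ℂ) : ℂ := (∑ x ∈ s, f x) / s.card

/-- Logarithmic average of a complex-valued function over a finite set of naturals. -/
def logAvgC (s : Finset ℕ) (f : ℕ → ℂ) : ℂ :=
  (∑ n ∈ s, f n / (n : ℂ)) / (∑ n ∈ s, (1 : ℂ) / (n : ℂ))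

/-- Logarithmic average of a real-valued function over a finite set of naturals. -/
def logAvgR (s : Finset ℕ) (f : ℕ → ℝ) : ℝ :=
  (∑ n ∈ s, f n / (n : ℝ)) / (∑ n ∈ s, (1 : ℝ) / (n : ℝ))

/-- A set `S` of integers is `(L, L', D)`-diophantine: whenever `δ ∈ (0, 1/2)` and
`|𝔼_{s ∈ S} e(θ s)| ≥ δ`, there is `q ∈ ℕ` with `q ≤ (L'/δ)^L` and
`‖qθ‖_{ℝ/ℤ} ≤ (L'/δ)^L / D`. -/
def IsDiophantine (L L' D : ℝ) (S : Finset ℤ) : Prop :=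
  ∀ δ θ : ℝ, 0 < δ → δ < 1 / 2 →
    δ ≤ ‖avgC S (fun s => eC (θ * (s : ℝ)))‖ →
    ∃ q : ℕ, 0 < q ∧ (q : ℝ) ≤ (L' / δ) ^ L ∧ dZ ((q : ℝ) * θ) ≤ (L' / δ) ^ L / D

/-- Extension by zero of `f : ℕ → ℂ` to `ℤ`. -/
def ext0 (f : ℕ → ℂ) : ℤ → ℂ := fun m => if 0 ≤ m then f m.toNat else 0

/-- The square of the norm `‖f‖_{U¹_log[N; q, H]}`. -/
def U1logSq (N q H : ℕ) (f : ℕ → ℂ) : ℝ :=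
  logAvgR (Finset.Icc 1 N)
    (fun n => ‖avgC (Finset.Icc 1 H) (fun h => f (n + h * q))‖ ^ 2)

/-- The norm `‖f‖_{U¹_log[N; q, H]}`. -/
def U1log (N q H : ℕ) (f : ℕ → ℂ) : ℝ := Real.sqrt (U1logSq N q H f)

lemma eC_eq (x : ℝ) : eC x = Complex.exp ((2 * Real.pi * x : ℝ) * Complex.I) := by
  unfold eC
  push_cast
  ring_nf

lemma norm_eC (x : ℝ) : ‖eC x‖ = 1 := by
  rw [eC_eq, Complex.norm_exp_ofReal_mul_I]

lemma eC_add (x y : ℝ) : eC (x + y) = eC x * eC y := by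
  unfold eC
  rw [← Complex.exp_add]
  push_cast
  ring_nf

lemma conj_eC (x : ℝ) : (starRingEnd ℂ) (eC x) = eC (-x) := by
  rw [eC_eq, eC_eq, ← Complex.exp_conj, map_mul, Complex.conj_ofReal, Complex.conj_I]
  push_cast
  ring_nf

lemma eC_int (k : ℤ) : eC k = 1 := by
  unfold eC
  rw [Complex.exp_eq_one_iff]
  exact ⟨k, by push_cast; ring⟩

@[fun_prop]
lemma continuous_eC : Continuous eC := by
  unfold eC
  fun_prop

lemma norm_eC_sub_one_le (x : ℝ) : ‖eC x - 1‖ ≤ 2 * Real.pi * |x| := by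
  rw [eC_eq, mul_comm]
  refine (Real.norm_exp_I_mul_ofReal_sub_one_le).trans ?_
  rw [Real.norm_eq_abs, abs_mul, abs_of_pos Real.two_pi_pos]

lemma integral_eC (k : ℤ) : ∫ θ in (0 : ℝ)..1, eC (k * θ) = if k = 0 then 1 else 0 := by
  split_ifs with hk
  · subst hk
    simp [eC]
  · have hc : (2 * Real.pi * Complex.I * k : ℂ) ≠ 0 := by
      simp [Real.pi_ne_zero, hk]
    have h := integral_exp_mul_complex (a := 0) (b := 1) hc
    have e : ∀ θ : ℝ, eC (k * θ) = Complex.exp (2 * Real.pi * Complex.I * k * θ) := by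
      intro θ
      unfold eC
      push_cast
      ring_nf
    simp_rw [e]
    rw [h]
    have h1 : Complex.exp (2 * Real.pi * Complex.I * k * (1 : ℝ)) = 1 := by
      rw [Complex.exp_eq_one_iff]
      exact ⟨k, by push_cast; ring⟩
    rw [h1]
    simp

/-- Parseval's identity for trigonometric polynomials. -/
lemma integral_norm_sq_trigPoly (J : Finset ℤ) (c : ℤ → ℂ) :
    ∫ θ in (0 : ℝ)..1, ‖∑ n ∈ J, c n * eC (-(n * θ))‖ ^ 2 = ∑ n ∈ J, ‖c n‖ ^ 2 := by
  have key : ∀ θ : ℝ, ((‖∑ n ∈ J, c n * eC (-(n * θ))‖ ^ 2 : ℝ) : ℂ)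
      = ∑ n ∈ J, ∑ m ∈ J, c n * (starRingEnd ℂ) (c m) * eC (((m - n : ℤ) : ℝ) * θ) := by
    intro θ
    push_cast
    rw [← Complex.mul_conj', map_sum, Finset.sum_mul_sum]
    refine Finset.sum_congr rfl fun n _ => Finset.sum_congr rfl fun m _ => ?_
    rw [map_mul, conj_eC]
    have : eC (((m : ℝ) - n) * θ) = eC (-(n * θ)) * eC (- -(m * θ)) := by
      rw [← eC_add]
      ring_nf
    rw [this]
    ring
  have h : ((∫ θ in (0 : ℝ)..1, ‖∑ n ∈ J, c n * eC (-(n * θ))‖ ^ 2 : ℝ) : ℂ)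
      = ((∑ n ∈ J, ‖c n‖ ^ 2 : ℝ) : ℂ) := by
    rw [← intervalIntegral.integral_ofReal]
    simp_rw [key]
    rw [intervalIntegral.integral_finsetSum
      (fun n _ => Continuous.intervalIntegrable (by fun_prop) _ _)]
    rw [Complex.ofReal_sum]
    refine Finset.sum_congr rfl fun n hn => ?_
    rw [intervalIntegral.integral_finsetSum
      (fun m _ => Continuous.intervalIntegrable (by fun_prop) _ _)]
    simp_rw [intervalIntegral.integral_const_mul, integral_eC]
    rw [Finset.sum_eq_single n]
    · simp [Complex.mul_conj']
    · intro m _ hmn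
      simp [sub_eq_zero, hmn]
    · exact fun h => absurd hn h
  exact_mod_cast h

lemma sum_shift {E : Type*} [AddCommMonoid E] [TopologicalSpace E] [T2Space E]
    (A J : Finset ℤ) (φ : ℤ → E) (m : ℤ)
    (hφ : ∀ k, k ∉ A → φ k = 0) (hJ : ∀ k ∈ A, k - m ∈ J) :
    ∑ n ∈ J, φ (n + m) = ∑ k ∈ A, φ k := by
  have hA : ∑' k, φ k = ∑ k ∈ A, φ k := tsum_eq_sum hφ
  have hJ' : ∑' n, φ (n + m) = ∑ n ∈ J, φ (n + m) := by
    refine tsum_eq_sum fun n hn => hφ _ fun h => hn ?_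
    simpa using hJ _ h
  rw [← hA, ← hJ']
  exact (Equiv.addRight m).tsum_eq φ

lemma avgC_mul_trigPoly {ι : Type*} (I : Finset ι) (m : ι → ℤ) (A J : Finset ℤ) (F : ℤ → ℂ)
    (hF : ∀ k, k ∉ A → F k = 0) (hJ : ∀ i ∈ I, ∀ k ∈ A, k - m i ∈ J) (θ : ℝ) :
    avgC I (fun i => eC (m i * θ)) * ∑ k ∈ A, F k * eC (-(k * θ))
      = ∑ n ∈ J, avgC I (fun i => F (n + m i)) * eC (-(n * θ)) := by
  unfold avgC
  simp_rw [div_mul_eq_mul_div]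
  rw [← Finset.sum_div]
  congr 1
  simp_rw [Finset.sum_mul]
  rw [Finset.sum_comm]
  refine Finset.sum_congr rfl fun i hi => ?_
  have := sum_shift A J (fun k => F k * eC (-(((k - m i : ℤ) : ℝ) * θ))) (m i)
    (fun k hk => by simp [hF k hk]) (hJ i hi)
  simp only [add_sub_cancel_right] at this
  rw [this, Finset.mul_sum]
  refine Finset.sum_congr rfl fun k _ => ?_
  have : eC (-(((k - m i : ℤ) : ℝ) * θ)) = eC (m i * θ) * eC (-(k * θ)) := by
    rw [← eC_add]
    push_cast
    ring_nf
  rw [this]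
  ring

lemma integral_avgC_mul_trigPoly {ι : Type*} (I : Finset ι) (m : ι → ℤ) (A J : Finset ℤ)
    (F : ℤ → ℂ) (hF : ∀ k, k ∉ A → F k = 0) (hJ : ∀ i ∈ I, ∀ k ∈ A, k - m i ∈ J) :
    ∫ θ in (0 : ℝ)..1, ‖avgC I (fun i => eC (m i * θ))‖ ^ 2 *
        ‖∑ k ∈ A, F k * eC (-(k * θ))‖ ^ 2
      = ∑ n ∈ J, ‖avgC I (fun i => F (n + m i))‖ ^ 2 := by
  simp_rw [← mul_pow, ← norm_mul, avgC_mul_trigPoly I m A J F hF hJ]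
  exact integral_norm_sq_trigPoly J _

lemma norm_avgC_sq_le {ι : Type*} (I : Finset ι) (x : ι → ℂ) :
    ‖avgC I x‖ ^ 2 ≤ (∑ i ∈ I, ‖x i‖ ^ 2) / I.card := by
  rcases I.eq_empty_or_nonempty with rfl | hI
  · simp [avgC]
  have hc : (0 : ℝ) < I.card := by exact_mod_cast hI.card_pos
  unfold avgC
  rw [norm_div, Complex.norm_natCast, div_pow, div_le_div_iff₀ (by positivity) hc]
  have h1 : ‖∑ i ∈ I, x i‖ ^ 2 ≤ (∑ i ∈ I, ‖x i‖) ^ 2 := by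
    gcongr
    exact norm_sum_le _ _
  have h2 := sq_sum_le_card_mul_sum_sq (s := I) (f := fun i => ‖x i‖)
  calc _ ≤ (I.card * ∑ i ∈ I, ‖x i‖ ^ 2) * I.card := by
        gcongr
        exact h1.trans h2
    _ = _ := by ring

lemma norm_avgC_le_one {ι : Type*} (I : Finset ι) (x : ι → ℂ) (hx : ∀ i ∈ I, ‖x i‖ ≤ 1) :
    ‖avgC I x‖ ≤ 1 := by
  unfold avgC
  rw [norm_div, Complex.norm_natCast]
  refine div_le_one_of_le₀ ?_ (by positivity)
  refine (norm_sum_le_of_le I hx).trans ?_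
  simp

/-- If a spectral inequality between averaging operators holds at every frequency, then it holds
for every finitely supported function. -/
lemma spectral_transfer (S : Finset ℤ) (T H K : ℕ) (a : ℝ) (A J : Finset ℤ) (F : ℤ → ℂ)
    (hF : ∀ k, k ∉ A → F k = 0)
    (hJ₁ : ∀ s ∈ S, ∀ t ∈ Icc 1 T, ∀ k ∈ A, k - (t : ℤ) * s ∈ J)
    (hJ₂ : ∀ q ∈ Icc 1 K, ∀ h ∈ Icc 1 H, ∀ k ∈ A, k - (h : ℤ) * (q : ℤ) ∈ J)
    (hθ : ∀ θ : ℝ,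
      (∑ s ∈ S, ‖avgC (Icc 1 T) (fun t => eC (((t : ℤ) * s : ℤ) * θ))‖ ^ 2) / S.card
        ≤ a + 4 * ∑ q ∈ Icc 1 K, ‖avgC (Icc 1 H) (fun h => eC (((h : ℤ) * (q : ℤ) : ℤ) * θ))‖ ^ 2) :
    (∑ s ∈ S, ∑ n ∈ J, ‖avgC (Icc 1 T) (fun t => F (n + (t : ℤ) * s))‖ ^ 2) / S.card
      ≤ a * ∑ k ∈ A, ‖F k‖ ^ 2
        + 4 * ∑ q ∈ Icc 1 K, ∑ n ∈ J, ‖avgC (Icc 1 H) (fun h => F (n + (h : ℤ) * (q : ℤ)))‖ ^ 2 := by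
  have e₁ : ∀ s ∈ S, ∑ n ∈ J, ‖avgC (Icc 1 T) (fun t => F (n + (t : ℤ) * s))‖ ^ 2
      = ∫ θ in (0 : ℝ)..1, ‖avgC (Icc 1 T) (fun t => eC (((t : ℤ) * s : ℤ) * θ))‖ ^ 2 *
        ‖∑ k ∈ A, F k * eC (-(k * θ))‖ ^ 2 := fun s hs =>
    (integral_avgC_mul_trigPoly (Icc 1 T) (fun t : ℕ => (t : ℤ) * s) A J F hF (hJ₁ s hs)).symm
  have e₂ : ∀ q ∈ Icc 1 K, ∑ n ∈ J, ‖avgC (Icc 1 H) (fun h => F (n + (h : ℤ) * (q : ℤ)))‖ ^ 2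
      = ∫ θ in (0 : ℝ)..1, ‖avgC (Icc 1 H) (fun h => eC (((h : ℤ) * (q : ℤ) : ℤ) * θ))‖ ^ 2 *
        ‖∑ k ∈ A, F k * eC (-(k * θ))‖ ^ 2 := fun q hq =>
    (integral_avgC_mul_trigPoly (Icc 1 H) (fun h : ℕ => (h : ℤ) * (q : ℤ)) A J F hF
      (hJ₂ q hq)).symm
  have cont : ∀ (I : Finset ℕ) (m : ℕ → ℤ),
      Continuous fun θ : ℝ => ‖avgC I (fun i => eC (m i * θ))‖ ^ 2 := by
    intro I m
    unfold avgC
    fun_prop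
  have cont' : Continuous fun θ : ℝ => ‖∑ k ∈ A, F k * eC (-(k * θ))‖ ^ 2 := by
    fun_prop
  have c₁ : ∀ s : ℤ, Continuous fun θ : ℝ =>
      ‖avgC (Icc 1 T) (fun t => eC (((t : ℤ) * s : ℤ) * θ))‖ ^ 2 *
        ‖∑ k ∈ A, F k * eC (-(k * θ))‖ ^ 2 :=
    fun s => (cont (Icc 1 T) (fun t : ℕ => (t : ℤ) * s)).mul cont'
  have c₂ : ∀ q : ℕ, Continuous fun θ : ℝ =>
      ‖avgC (Icc 1 H) (fun h => eC (((h : ℤ) * (q : ℤ) : ℤ) * θ))‖ ^ 2 *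
        ‖∑ k ∈ A, F k * eC (-(k * θ))‖ ^ 2 :=
    fun q => (cont (Icc 1 H) (fun h : ℕ => (h : ℤ) * (q : ℤ))).mul cont'
  rw [Finset.sum_congr rfl e₁, Finset.sum_congr rfl e₂, ← integral_norm_sq_trigPoly A F,
    ← intervalIntegral.integral_finsetSum
      (fun s _ => (c₁ s).intervalIntegrable _ _),
    ← intervalIntegral.integral_finsetSum
      (fun q _ => (c₂ q).intervalIntegrable _ _),
    ← intervalIntegral.integral_div, ← intervalIntegral.integral_const_mul,
    ← intervalIntegral.integral_const_mul, ← intervalIntegral.integral_add]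
  · refine intervalIntegral.integral_mono_on zero_le_one ?_ ?_ fun θ _ => ?_
    · exact ((continuous_finsetSum _ fun s _ => c₁ s).div_const _).intervalIntegrable
        _ _
    · exact ((continuous_const.mul cont').add (continuous_const.mul
        (continuous_finsetSum _ fun q _ => c₂ q))).intervalIntegrable _ _
    · rw [← Finset.sum_mul, ← Finset.sum_mul]
      have := mul_le_mul_of_nonneg_right (hθ θ)
        (sq_nonneg ‖∑ k ∈ A, F k * eC (-(k * θ))‖)
      calc _ = _ := by ring
        _ ≤ _ := this
        _ = _ := by ring
  · exact (continuous_const.mul cont').intervalIntegrable _ _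
  · exact (continuous_const.mul
        (continuous_finsetSum _ fun q _ => c₂ q)).intervalIntegrable _ _

/-- The logarithmic weight `1 / k` on `{1, …, N}`, extended by zero to `ℤ`. -/
def recipWeight (N : ℕ) (k : ℤ) : ℝ := if k ∈ Icc 1 (N : ℤ) then 1 / (k : ℝ) else 0

lemma recipWeight_of_mem {N : ℕ} {k : ℤ} (h₁ : 1 ≤ k) (h₂ : k ≤ N) :
    recipWeight N k = 1 / (k : ℝ) := if_pos (by simp [h₁, h₂])

lemma recipWeight_of_notMem {N : ℕ} {k : ℤ} (h : k ∉ Icc 1 (N : ℤ)) :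
    recipWeight N k = 0 := if_neg h

lemma recipWeight_nonneg (N : ℕ) (k : ℤ) : 0 ≤ recipWeight N k := by
  unfold recipWeight
  split_ifs with h
  · have : (1 : ℝ) ≤ k := by exact_mod_cast (Finset.mem_Icc.1 h).1
    positivity
  · exact le_rfl

lemma recipWeight_le_of_le (N : ℕ) {a b : ℤ} (ha : 1 ≤ a) (hab : a ≤ b) :
    recipWeight N b ≤ recipWeight N a := by
  by_cases hb : b ≤ N
  · rw [recipWeight_of_mem (by omega) hb, recipWeight_of_mem ha (by omega)]
    have : (1 : ℝ) ≤ a := by exact_mod_cast ha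
    have : (a : ℝ) ≤ b := by exact_mod_cast hab
    gcongr
  · rw [recipWeight_of_notMem (k := b) (by simp; omega)]
    exact recipWeight_nonneg _ _

lemma recipWeight_le_recipWeight (N R : ℕ) {k : ℤ} (hk : k ≤ R) :
    recipWeight N k ≤ recipWeight R k := by
  by_cases h : k ∈ Icc 1 (N : ℤ)
  · rw [Finset.mem_Icc] at h
    rw [recipWeight_of_mem h.1 h.2, recipWeight_of_mem h.1 hk]
  · rw [recipWeight_of_notMem h]
    exact recipWeight_nonneg _ _

lemma recipWeight_eq_zero_of_nonpos (N : ℕ) {k : ℤ} (hk : k ≤ 0) : recipWeight N k = 0 :=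
  recipWeight_of_notMem (by simp; omega)

lemma abs_recipWeight_sub_le_of_nonneg (N R : ℕ) {m : ℤ} (h0 : 0 ≤ m) (hm : m ≤ R) (n : ℤ) :
    |recipWeight N (n + m) - recipWeight N n|
      ≤ recipWeight N n - recipWeight N (n + m) + 2 * recipWeight R (n + m) := by
  rcases le_or_gt 1 n with hn | hn
  · rw [abs_of_nonpos (sub_nonpos.2 (recipWeight_le_of_le N hn (by omega)))]
    linarith [recipWeight_nonneg R (n + m)]
  · rw [recipWeight_eq_zero_of_nonpos N (k := n) (by omega), sub_zero,
      abs_of_nonneg (recipWeight_nonneg _ _)]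
    linarith [recipWeight_le_recipWeight N R (k := n + m) (by omega)]

lemma abs_recipWeight_sub_le_of_nonpos (N R : ℕ) {m : ℤ} (h0 : m ≤ 0) (hm : -m ≤ R) (n : ℤ) :
    |recipWeight N (n + m) - recipWeight N n|
      ≤ recipWeight N (n + m) - recipWeight N n + 2 * recipWeight R n := by
  have := abs_recipWeight_sub_le_of_nonneg N R (m := -m) (by omega) hm (n + m)
  rw [add_neg_cancel_right, abs_sub_comm] at this
  exact this

/-- An interval containing all shifts by at most `2 * R` of `{1, …, N}` and of `{1, …, R}`. -/
def window (N R : ℕ) : Finset ℤ := Icc (-(2 * R) : ℤ) (N + 2 * R)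

lemma sum_window_recipWeight {N R M : ℕ} {m : ℤ} (hM : M ≤ N ∨ M ≤ R) (hm : |m| ≤ R) :
    ∑ n ∈ window N R, recipWeight M (n + m) = ∑ k ∈ Icc 1 (M : ℤ), recipWeight M k := by
  refine sum_shift _ _ (recipWeight M) m (fun k hk => recipWeight_of_notMem hk) fun k hk => ?_
  rw [abs_le] at hm
  simp only [window, Finset.mem_Icc] at hk ⊢
  omega

lemma sum_abs_recipWeight_sub_le (N R : ℕ) {m : ℤ} (hm : |m| ≤ R) :
    ∑ n ∈ window N R, |recipWeight N (n + m) - recipWeight N n|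
      ≤ 2 * ∑ k ∈ Icc 1 (R : ℤ), recipWeight R k := by
  have e₁ := sum_window_recipWeight (N := N) (R := R) (M := N) (Or.inl le_rfl) hm
  have e₂ := sum_window_recipWeight (N := N) (R := R) (M := N) (m := 0) (Or.inl le_rfl) (by simp)
  have e₃ := sum_window_recipWeight (N := N) (R := R) (M := R) (Or.inr le_rfl) hm
  have e₄ := sum_window_recipWeight (N := N) (R := R) (M := R) (m := 0) (Or.inr le_rfl) (by simp)
  simp only [add_zero] at e₂ e₄
  have hm' := abs_le.1 hm
  rcases le_total 0 m with h0 | h0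
  · refine (Finset.sum_le_sum fun n _ =>
      abs_recipWeight_sub_le_of_nonneg N R h0 hm'.2 n).trans ?_
    rw [Finset.sum_add_distrib, Finset.sum_sub_distrib, ← Finset.mul_sum, e₁, e₂, e₃]
    simp
  · refine (Finset.sum_le_sum fun n _ =>
      abs_recipWeight_sub_le_of_nonpos N R h0 (by omega) n).trans ?_
    rw [Finset.sum_add_distrib, Finset.sum_sub_distrib, ← Finset.mul_sum, e₁, e₂, e₄]
    simp

lemma sq_sqrt_sub_sqrt_le {a b : ℝ} (ha : 0 ≤ a) (hb : 0 ≤ b) :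
    (√a - √b) ^ 2 ≤ |a - b| := by
  have h : |a - b| = |√a - √b| * (√a + √b) := by
    rw [← abs_of_nonneg (add_nonneg (Real.sqrt_nonneg a) (Real.sqrt_nonneg b)), ← abs_mul]
    congr 1
    nlinarith [Real.sq_sqrt ha, Real.sq_sqrt hb]
  rw [h, ← sq_abs, sq]
  gcongr
  rw [abs_le]
  constructor <;> linarith [Real.sqrt_nonneg a, Real.sqrt_nonneg b]

/-- Averages of shifts of the weighted function `g / √n` are close in `ℓ²` to weighted averages of
shifts. -/
lemma sum_norm_avgC_sub_sq_le {ι : Type*} (g : ℤ → ℂ) (hg : ∀ k, ‖g k‖ ≤ 1) (N R : ℕ)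
    (I : Finset ι) (hI : I.Nonempty) (m : ι → ℤ) (hm : ∀ i ∈ I, |m i| ≤ R) :
    ∑ n ∈ window N R, ‖avgC I (fun i => g (n + m i) * (√(recipWeight N (n + m i)) : ℝ))
        - (√(recipWeight N n) : ℝ) * avgC I (fun i => g (n + m i))‖ ^ 2
      ≤ 2 * ∑ k ∈ Icc 1 (R : ℤ), recipWeight R k := by
  have hc : (0 : ℝ) < I.card := by exact_mod_cast hI.card_pos
  have h1 : ∀ n : ℤ, ‖avgC I (fun i => g (n + m i) * (√(recipWeight N (n + m i)) : ℝ))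
        - (√(recipWeight N n) : ℝ) * avgC I (fun i => g (n + m i))‖ ^ 2
      ≤ (∑ i ∈ I, |recipWeight N (n + m i) - recipWeight N n|) / I.card := by
    intro n
    have e : avgC I (fun i => g (n + m i) * (√(recipWeight N (n + m i)) : ℝ))
        - (√(recipWeight N n) : ℝ) * avgC I (fun i => g (n + m i))
        = avgC I (fun i => g (n + m i) *
            ((√(recipWeight N (n + m i)) - √(recipWeight N n) : ℝ) : ℂ)) := by
      unfold avgC
      rw [← mul_div_assoc, ← sub_div, Finset.mul_sum, ← Finset.sum_sub_distrib]
      congr 1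
      refine Finset.sum_congr rfl fun i _ => ?_
      push_cast
      ring
    rw [e]
    refine (norm_avgC_sq_le _ _).trans ?_
    gcongr with i hi
    rw [norm_mul, mul_pow, Complex.norm_real, Real.norm_eq_abs, sq_abs]
    calc _ ≤ 1 ^ 2 * (√(recipWeight N (n + m i)) - √(recipWeight N n)) ^ 2 := by
          gcongr
          exact hg _
      _ ≤ _ := by
          rw [one_pow, one_mul]
          exact sq_sqrt_sub_sqrt_le (recipWeight_nonneg _ _) (recipWeight_nonneg _ _)
  refine (Finset.sum_le_sum fun n _ => h1 n).trans ?_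
  rw [← Finset.sum_div, Finset.sum_comm, div_le_iff₀ hc]
  refine (Finset.sum_le_sum fun i hi => sum_abs_recipWeight_sub_le N R (hm i hi)).trans ?_
  rw [Finset.sum_const, nsmul_eq_mul, mul_comm]

lemma norm_sq_le_two_mul_add {E : Type*} [SeminormedAddCommGroup E] (a b : E) :
    ‖a‖ ^ 2 ≤ 2 * ‖b‖ ^ 2 + 2 * ‖a - b‖ ^ 2 := by
  have h : ‖a‖ ≤ ‖b‖ + ‖a - b‖ := by
    simpa using norm_add_le b (a - b)
  nlinarith [norm_nonneg a, norm_nonneg b, norm_nonneg (a - b), sq_nonneg (‖b‖ - ‖a - b‖)]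

lemma norm_sqrt_mul_sq {a : ℝ} (ha : 0 ≤ a) (z : ℂ) :
    ‖((√a : ℝ) : ℂ) * z‖ ^ 2 = a * ‖z‖ ^ 2 := by
  rw [norm_mul, mul_pow, Complex.norm_real, Real.norm_eq_abs, sq_abs, Real.sq_sqrt ha]

lemma sum_weighted_le_sum_shifted {ι : Type*} (g : ℤ → ℂ) (hg : ∀ k, ‖g k‖ ≤ 1) (N R : ℕ)
    (I : Finset ι) (hI : I.Nonempty) (m : ι → ℤ) (hm : ∀ i ∈ I, |m i| ≤ R) :
    ∑ n ∈ window N R, recipWeight N n * ‖avgC I (fun i => g (n + m i))‖ ^ 2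
      ≤ 2 * ∑ n ∈ window N R,
          ‖avgC I (fun i => g (n + m i) * (√(recipWeight N (n + m i)) : ℝ))‖ ^ 2
        + 4 * ∑ k ∈ Icc 1 (R : ℤ), recipWeight R k := by
  have h := sum_norm_avgC_sub_sq_le g hg N R I hI m hm
  simp_rw [← norm_sqrt_mul_sq (recipWeight_nonneg _ _)]
  refine (Finset.sum_le_sum fun n _ => norm_sq_le_two_mul_add _
    (avgC I (fun i => g (n + m i) * (√(recipWeight N (n + m i)) : ℝ)))).trans ?_
  rw [Finset.sum_add_distrib, ← Finset.mul_sum, ← Finset.mul_sum]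
  simp_rw [norm_sub_rev (((√(recipWeight N _) : ℝ) : ℂ) * _)]
  linarith

lemma sum_shifted_le_sum_weighted {ι : Type*} (g : ℤ → ℂ) (hg : ∀ k, ‖g k‖ ≤ 1) (N R : ℕ)
    (I : Finset ι) (hI : I.Nonempty) (m : ι → ℤ) (hm : ∀ i ∈ I, |m i| ≤ R) :
    ∑ n ∈ window N R,
          ‖avgC I (fun i => g (n + m i) * (√(recipWeight N (n + m i)) : ℝ))‖ ^ 2
      ≤ 2 * ∑ n ∈ window N R, recipWeight N n * ‖avgC I (fun i => g (n + m i))‖ ^ 2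
        + 4 * ∑ k ∈ Icc 1 (R : ℤ), recipWeight R k := by
  have h := sum_norm_avgC_sub_sq_le g hg N R I hI m hm
  simp_rw [← norm_sqrt_mul_sq (recipWeight_nonneg _ _)]
  refine (Finset.sum_le_sum fun n _ => norm_sq_le_two_mul_add _
    (((√(recipWeight N n) : ℝ) : ℂ) * avgC I (fun i => g (n + m i)))).trans ?_
  rw [Finset.sum_add_distrib, ← Finset.mul_sum, ← Finset.mul_sum]
  linarith

lemma sum_Icc_int_eq_sum_Icc_nat (N : ℕ) (φ : ℤ → ℝ) :
    ∑ k ∈ Icc 1 (N : ℤ), φ k = ∑ n ∈ Icc 1 N, φ (n : ℤ) := by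
  symm
  refine Finset.sum_nbij' (fun n => (n : ℤ)) Int.toNat ?_ ?_ ?_ ?_ ?_
  all_goals
    intro n hn
    simp only [Finset.mem_Icc] at hn ⊢
    try omega

lemma sum_window_recipWeight_mul (N R : ℕ) (X : ℤ → ℝ) :
    ∑ n ∈ window N R, recipWeight N n * X n = ∑ n ∈ Icc 1 N, X n / n := by
  have h := sum_shift (Icc 1 (N : ℤ)) (window N R) (fun k => recipWeight N k * X k) 0
    (fun k hk => by simp [recipWeight_of_notMem hk])
    (fun k hk => by simp only [window, Finset.mem_Icc] at hk ⊢; omega)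
  simp only [add_zero] at h
  rw [h, sum_Icc_int_eq_sum_Icc_nat]
  refine Finset.sum_congr rfl fun n hn => ?_
  rw [Finset.mem_Icc] at hn
  rw [recipWeight_of_mem (by omega) (by omega)]
  push_cast
  ring

lemma sum_recipWeight (N : ℕ) :
    ∑ k ∈ Icc 1 (N : ℤ), recipWeight N k = ∑ n ∈ Icc 1 N, 1 / (n : ℝ) := by
  rw [sum_Icc_int_eq_sum_Icc_nat]
  refine Finset.sum_congr rfl fun n hn => ?_
  rw [Finset.mem_Icc] at hn
  rw [recipWeight_of_mem (by omega) (by omega)]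
  push_cast
  rfl

lemma sum_one_div_eq_harmonic (N : ℕ) : ∑ n ∈ Icc 1 N, 1 / (n : ℝ) = harmonic N := by
  rw [harmonic_eq_sum_Icc]
  push_cast
  simp

lemma log_le_sum_one_div {N : ℕ} (hN : 1 ≤ N) :
    Real.log N ≤ ∑ n ∈ Icc 1 N, 1 / (n : ℝ) := by
  rw [sum_one_div_eq_harmonic]
  refine le_trans (Real.log_le_log (by exact_mod_cast hN) ?_) (log_add_one_le_harmonic N)
  push_cast
  linarith

lemma sum_one_div_le_one_add_log (N : ℕ) :
    ∑ n ∈ Icc 1 N, 1 / (n : ℝ) ≤ 1 + Real.log N := by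
  rw [sum_one_div_eq_harmonic]
  exact harmonic_le_one_add_log N

lemma exists_pair_same_class {A w : ℝ} {T : ℕ} (hA1 : 1 ≤ A) (hwT : w ≤ T)
    (hwA : 4 * A ^ 2 ≤ w) {P : Finset ℕ} (hP : P ⊆ Icc 1 T) (hcard : (T : ℝ) / A ≤ P.card)
    (q : ℕ → ℕ) (hq0 : ∀ t ∈ P, 0 < q t) (hqA : ∀ t ∈ P, (q t : ℝ) ≤ A) :
    ∃ t₁ ∈ P, ∃ t₂ ∈ P, q t₁ = q t₂ ∧ w / (4 * A ^ 2) ≤ (t₂ : ℝ) - t₁ ∧ (t₂ : ℝ) - t₁ ≤ w := by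
  have hA0 : 0 < A := by linarith
  have hw0 : 0 < w := lt_of_lt_of_le (by positivity) hwA
  have hmaps : ∀ t ∈ P, (fun t : ℕ => (q t, ⌊(t : ℝ) / w⌋₊)) t
      ∈ Icc 1 ⌊A⌋₊ ×ˢ range (⌊(T : ℝ) / w⌋₊ + 1) := by
    intro t ht
    have htT : (t : ℝ) ≤ T := by exact_mod_cast (Finset.mem_Icc.1 (hP ht)).2
    simp only [Finset.mem_product, Finset.mem_Icc, Finset.mem_range]
    refine ⟨⟨hq0 t ht, Nat.le_floor (hqA t ht)⟩, Nat.lt_succ_of_le (Nat.floor_mono ?_)⟩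
    gcongr
  have htarget : ((Icc 1 ⌊A⌋₊ ×ˢ range (⌊(T : ℝ) / w⌋₊ + 1)).card : ℝ) ≤ A * (2 * (T / w)) := by
    rw [Finset.card_product, Nat.card_Icc, Finset.card_range, Nat.add_sub_cancel]
    push_cast
    have h1 : (⌊A⌋₊ : ℝ) ≤ A := Nat.floor_le hA0.le
    have h2 : (⌊(T : ℝ) / w⌋₊ : ℝ) ≤ T / w := Nat.floor_le (by positivity)
    have h3 : 1 ≤ (T : ℝ) / w := by rwa [one_le_div hw0]
    gcongr
    linarith
  have hne : (Icc 1 ⌊A⌋₊ ×ˢ range (⌊(T : ℝ) / w⌋₊ + 1)).Nonempty := by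
    refine ⟨(1, 0), ?_⟩
    simp only [Finset.mem_product, Finset.mem_Icc, Finset.mem_range]
    exact ⟨⟨le_rfl, Nat.le_floor (by simpa using hA1)⟩, Nat.succ_pos _⟩
  obtain ⟨y, -, hy⟩ := Finset.exists_le_card_fiber_of_nsmul_le_card_of_maps_to
    (b := w / (2 * A ^ 2)) hmaps hne (by
      rw [nsmul_eq_mul]
      calc _ ≤ A * (2 * (T / w)) * (w / (2 * A ^ 2)) := by gcongr
        _ = T / A := by field_simp
        _ ≤ _ := hcard)
  set Y := P.filter fun t => (q t, ⌊(t : ℝ) / w⌋₊) = y with hY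
  have hw2 : 2 ≤ w / (2 * A ^ 2) := by
    rw [le_div_iff₀ (by positivity)]
    linarith
  have hYne : Y.Nonempty := by
    rw [← Finset.card_pos]
    have : (0 : ℝ) < Y.card := lt_of_lt_of_le (by linarith) hy
    exact_mod_cast this
  obtain ⟨t₁, ht₁⟩ : ∃ t₁, t₁ = Y.min' hYne := ⟨_, rfl⟩
  obtain ⟨t₂, ht₂⟩ : ∃ t₂, t₂ = Y.max' hYne := ⟨_, rfl⟩
  have hm₁ : t₁ ∈ Y := ht₁ ▸ Y.min'_mem hYne
  have hm₂ : t₂ ∈ Y := ht₂ ▸ Y.max'_mem hYne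
  have hYsub : Y ⊆ Icc t₁ t₂ := fun t ht =>
    Finset.mem_Icc.2 ⟨ht₁ ▸ Y.min'_le t ht, ht₂ ▸ Y.le_max' t ht⟩
  have h12 : t₁ ≤ t₂ := (Finset.mem_Icc.1 (hYsub hm₁)).2
  have hcardY : (Y.card : ℝ) ≤ t₂ + 1 - t₁ := by
    have := Finset.card_le_card hYsub
    rw [Nat.card_Icc] at this
    have h' : Y.card + t₁ ≤ t₂ + 1 := by omega
    have : ((Y.card + t₁ : ℕ) : ℝ) ≤ ((t₂ + 1 : ℕ) : ℝ) := by exact_mod_cast h'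
    push_cast at this
    linarith
  have hk : w / (4 * A ^ 2) ≤ (t₂ : ℝ) - t₁ := by
    have : w / (2 * A ^ 2) = 2 * (w / (4 * A ^ 2)) := by
      field_simp
      norm_num
    linarith
  rw [hY, Finset.mem_filter] at hm₁ hm₂
  have hq12 : q t₁ = q t₂ := by
    have := hm₁.2.trans hm₂.2.symm
    exact (Prod.mk.inj this).1
  have hfl : ⌊(t₁ : ℝ) / w⌋₊ = ⌊(t₂ : ℝ) / w⌋₊ := by
    have := hm₁.2.trans hm₂.2.symm
    exact (Prod.mk.inj this).2
  have hkw : (t₂ : ℝ) - t₁ ≤ w := by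
    have h1 : (⌊(t₁ : ℝ) / w⌋₊ : ℝ) ≤ t₁ / w := Nat.floor_le (by positivity)
    have h2 : (t₂ : ℝ) / w < ⌊(t₂ : ℝ) / w⌋₊ + 1 := Nat.lt_floor_add_one _
    rw [hfl] at h1
    have h3 : (t₂ : ℝ) / w - t₁ / w ≤ 1 := by linarith
    rw [← sub_div, div_le_one hw0] at h3
    exact h3
  exact ⟨t₁, hm₁.1, t₂, hm₂.1, hq12, hk, hkw⟩

/-- Many multiples `(t₀ - t) θ` close to rationals of small denominator force `θ` itself to be
very close to such a rational. -/
lemma exists_small_denominator {A D θ : ℝ} {T : ℕ} (hA : 2 ^ 10 ≤ A) (hD : 2 ^ 16 * A ^ 7 ≤ D)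
    (hT : 2 ^ 16 * A ^ 7 ≤ T) (t₀ : ℤ) (P : Finset ℕ) (hP : P ⊆ Icc 1 T)
    (hcard : (T : ℝ) / A ≤ P.card)
    (h : ∀ t ∈ P, ∃ q : ℕ, 0 < q ∧ (q : ℝ) ≤ A ∧ dZ ((q : ℝ) * ((t₀ - t : ℝ) * θ)) ≤ A / D) :
    ∃ q : ℕ, 0 < q ∧ (q : ℝ) ≤ 9 * A ^ 3 ∧ ∃ a : ℤ, |q * θ - a| ≤ 72 * A ^ 6 / (D * T) := by
  have hA0 : 0 < A := by linarith
  have hA1 : 1 ≤ A := by linarith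
  have hD0 : 0 < D := lt_of_lt_of_le (by positivity) hD
  have hT0 : (0 : ℝ) < T := lt_of_lt_of_le (by positivity) hT
  have hn0 : 0 < ⌈8 * A ^ 3⌉₊ := Nat.ceil_pos.2 (by positivity)
  have hn : (⌈8 * A ^ 3⌉₊ : ℝ) ≤ 9 * A ^ 3 := by
    have := (Nat.ceil_lt_add_one (a := 8 * A ^ 3) (by positivity)).le
    nlinarith [one_le_pow₀ (n := 3) hA1]
  obtain ⟨q', hq'0, hq'n, hβ⟩ := Real.exists_nat_abs_mul_sub_round_le θ hn0
  set r : ℤ := round (q' * θ) with hr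
  set β : ℝ := q' * θ - r with hβdef
  have hq'A : (q' : ℝ) ≤ 9 * A ^ 3 := le_trans (by exact_mod_cast hq'n) hn
  refine ⟨q', hq'0, hq'A, r, ?_⟩
  have hβ' : |β| * (8 * A ^ 3) ≤ 1 := by
    have h1 : 8 * A ^ 3 ≤ (⌈8 * A ^ 3⌉₊ : ℝ) := Nat.le_ceil _
    have h2 : |β| * (⌈8 * A ^ 3⌉₊ + 1 : ℝ) ≤ 1 := by
      rwa [le_div_iff₀ (by positivity)] at hβ
    nlinarith [abs_nonneg β]
  have core : ∀ w : ℝ, w ≤ T → 4 * A ^ 2 ≤ w → 2 * A * w * |β| ≤ 1 →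
      |β| * w ≤ 72 * A ^ 6 / D := by
    intro w hwT hwA hwβ
    have hw0 : 0 < w := lt_of_lt_of_le (by positivity) hwA
    choose! q hq0 hqA hqd using h
    obtain ⟨t₁, hm₁, t₂, hm₂, hq12, hk, hkw⟩ :=
      exists_pair_same_class hA1 hwT hwA hP hcard q hq0 hqA
    have hd₁ := hqd t₁ hm₁
    have hd₂ := hqd t₂ hm₂
    have hQ1 : (1 : ℝ) ≤ q t₁ := by exact_mod_cast hq0 t₁ hm₁
    have hQA := hqA t₁ hm₁
    rw [← hq12] at hd₂
    unfold dZ at hd₁ hd₂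
    set Q : ℝ := ((q t₁ : ℕ) : ℝ) with hQ
    set a₁ : ℤ := round (Q * ((t₀ - t₁ : ℝ) * θ))
    set a₂ : ℤ := round (Q * ((t₀ - t₂ : ℝ) * θ))
    set k : ℝ := (t₂ : ℝ) - t₁ with hkdef
    have hk0 : 0 ≤ k := le_trans (by positivity) hk
    obtain ⟨z, hz⟩ : ∃ z : ℤ, (z : ℝ) = q' * (a₁ - a₂) - Q * k * r :=
      ⟨q' * (a₁ - a₂) - q t₁ * ((t₂ : ℤ) - t₁) * r, by push_cast [hQ, hkdef]; ring⟩
    have hxz : |Q * k * β - z| ≤ 18 * A ^ 4 / D := by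
      have e : Q * k * β - z = q' * ((Q * ((t₀ - t₁ : ℝ) * θ) - a₁)
          - (Q * ((t₀ - t₂ : ℝ) * θ) - a₂)) := by
        rw [hz, hβdef, hkdef]
        ring
      rw [e, abs_mul, Nat.abs_cast]
      calc _ ≤ 9 * A ^ 3 * (A / D + A / D) := by
            gcongr
            exact (abs_sub _ _).trans (add_le_add hd₁ hd₂)
        _ = _ := by ring
    have hsmall : 18 * A ^ 4 / D < 1 / 2 := by
      rw [div_lt_div_iff₀ hD0 two_pos]
      have : A ^ 4 ≤ A ^ 7 := pow_le_pow_right₀ hA1 (by norm_num)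
      nlinarith [pow_pos hA0 4]
    have hx : |Q * k * β| ≤ 1 / 2 := by
      rw [abs_mul, abs_of_nonneg (by positivity)]
      calc Q * k * |β| ≤ A * w * |β| := by gcongr
        _ ≤ 1 / 2 := by linarith
    have hz0 : z = 0 := by
      have : |(z : ℝ)| < 1 := by
        rw [abs_lt]
        rw [abs_le] at hx hxz
        constructor <;> linarith
      have : |z| < 1 := by exact_mod_cast this
      exact Int.abs_lt_one_iff.1 this
    rw [hz0, Int.cast_zero, sub_zero, abs_mul, abs_of_nonneg (by positivity)] at hxz
    have hfin : w / (4 * A ^ 2) * |β| ≤ 18 * A ^ 4 / D :=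
      calc w / (4 * A ^ 2) * |β| ≤ k * |β| := mul_le_mul_of_nonneg_right hk (abs_nonneg β)
        _ ≤ Q * k * |β| :=
          mul_le_mul_of_nonneg_right (le_mul_of_one_le_left hk0 hQ1) (abs_nonneg β)
        _ ≤ _ := hxz
    calc |β| * w = 4 * A ^ 2 * (w / (4 * A ^ 2) * |β|) := by field_simp
      _ ≤ 4 * A ^ 2 * (18 * A ^ 4 / D) := by gcongr
      _ = _ := by ring
  have hAT : 4 * A ^ 2 ≤ T := by
    have : A ^ 2 ≤ A ^ 7 := pow_le_pow_right₀ hA1 (by norm_num)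
    nlinarith [pow_pos hA0 2]
  by_cases hβT : 2 * A * T * |β| ≤ 1
  · have := core T le_rfl hAT hβT
    rw [← div_div, le_div_iff₀ hT0]
    exact this
  · exfalso
    push Not at hβT
    have hβ0 : 0 < |β| := by
      rcases (abs_nonneg β).eq_or_lt with h0 | h0
      · rw [← h0] at hβT
        norm_num at hβT
      · exact h0
    have hw := core (1 / (2 * A * |β|)) (by
        rw [div_le_iff₀ (by positivity)]
        linarith) (by
        rw [le_div_iff₀ (by positivity)]
        linarith) (by
        field_simp
        exact le_rfl)
    have e : |β| * (1 / (2 * A * |β|)) = 1 / (2 * A) := by field_simp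
    rw [e, div_le_div_iff₀ (by positivity) hD0] at hw
    have : 0 < A ^ 7 := by positivity
    nlinarith

lemma avgC_avgC_avgC_mul_conj {α β : Type*} (I : Finset α) (S : Finset β) (x : α → β → ℂ) :
    avgC I (fun t => avgC I (fun t' => avgC S (fun s => x t s * (starRingEnd ℂ) (x t' s))))
      = (((∑ s ∈ S, ‖avgC I (fun t => x t s)‖ ^ 2) / S.card : ℝ) : ℂ) := by
  have h : ∀ s, ((‖avgC I (fun t => x t s)‖ ^ 2 : ℝ) : ℂ)
      = (∑ t ∈ I, ∑ t' ∈ I, x t s * (starRingEnd ℂ) (x t' s)) / (I.card * I.card) := by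
    intro s
    push_cast
    rw [← Complex.mul_conj']
    unfold avgC
    rw [map_div₀, map_sum, map_natCast, div_mul_div_comm, Finset.sum_mul_sum]
  rw [Complex.ofReal_div, Complex.ofReal_sum, Finset.sum_congr rfl fun s _ => h s]
  unfold avgC
  simp_rw [← Finset.sum_div]
  rw [Complex.ofReal_natCast, Finset.sum_comm]
  simp_rw [Finset.sum_comm (s := S)]
  simp only [div_div]
  congr 1
  · rw [Finset.sum_comm]
  · ring

lemma exists_lt_norm_of_lt_norm_avgC {ι : Type*} (I : Finset ι) (x : ι → ℂ) {c : ℝ} (hc : 0 ≤ c)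
    (h : c < ‖avgC I x‖) : ∃ i ∈ I, c < ‖x i‖ := by
  by_contra! hcon
  refine absurd h (not_lt.2 ?_)
  rcases I.eq_empty_or_nonempty with rfl | hI
  · simpa [avgC] using hc
  have h0 : (0 : ℝ) < I.card := by exact_mod_cast hI.card_pos
  unfold avgC
  rw [norm_div, Complex.norm_natCast, div_le_iff₀ h0]
  refine (norm_sum_le_of_le I hcon).trans ?_
  rw [Finset.sum_const, nsmul_eq_mul, mul_comm]

lemma mul_card_le_card_filter (I : Finset ℕ) (x : ℕ → ℂ) (hx : ∀ i ∈ I, ‖x i‖ ≤ 1) {c : ℝ}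
    (hc : 0 ≤ c) (h : 2 * c ≤ ‖avgC I x‖) :
    c * I.card ≤ (I.filter fun i => c ≤ ‖x i‖).card := by
  rcases I.eq_empty_or_nonempty with rfl | hI
  · simp
  have h0 : (0 : ℝ) < I.card := by exact_mod_cast hI.card_pos
  unfold avgC at h
  rw [norm_div, Complex.norm_natCast, le_div_iff₀ h0] at h
  have h1 : ∑ i ∈ I, ‖x i‖ ≤ ∑ i ∈ I, ((if c ≤ ‖x i‖ then 1 else 0) + c) := by
    refine Finset.sum_le_sum fun i hi => ?_
    split_ifs with hi'
    · linarith [hx i hi]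
    · linarith
  rw [Finset.sum_add_distrib, Finset.sum_boole, Finset.sum_const, nsmul_eq_mul] at h1
  have := norm_sum_le I x
  linarith

/-- A frequency which is not negligible for the averages over the progressions `t * s` lies in a
major arc, where averages over some progression of small common difference do not decay. -/
lemma spectral_inequality {A D δ : ℝ} {T H K : ℕ} {S : Finset ℤ} (hA : 2 ^ 10 ≤ A)
    (hδ : 8 / A ≤ δ) (hD : 2 ^ 16 * A ^ 7 ≤ D) (hT : 2 ^ 16 * A ^ 7 ≤ T)
    (hS : ∀ θ : ℝ, δ / 8 ≤ ‖avgC S (fun s => eC (θ * (s : ℝ)))‖ →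
      ∃ q : ℕ, 0 < q ∧ (q : ℝ) ≤ A ∧ dZ ((q : ℝ) * θ) ≤ A / D)
    (hH0 : 0 < H) (hH : H * A ^ 25 ≤ T * D) (hK : K = ⌊9 * A ^ 3⌋₊) (θ : ℝ) :
    (∑ s ∈ S, ‖avgC (Icc 1 T) (fun t => eC (((t : ℤ) * s : ℤ) * θ))‖ ^ 2) / S.card
      ≤ δ / 4 + 4 * ∑ q ∈ Icc 1 K,
        ‖avgC (Icc 1 H) (fun h => eC (((h : ℤ) * (q : ℤ) : ℤ) * θ))‖ ^ 2 := by
  have hA0 : 0 < A := by linarith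
  have hA1 : 1 ≤ A := by linarith
  have hδ0 : 0 < δ := lt_of_lt_of_le (by positivity) hδ
  have hD0 : 0 < D := lt_of_lt_of_le (by positivity) hD
  have hT0 : (0 : ℝ) < T := lt_of_lt_of_le (by positivity) hT
  set W : ℝ := (∑ s ∈ S, ‖avgC (Icc 1 T) (fun t => eC (((t : ℤ) * s : ℤ) * θ))‖ ^ 2) / S.card
    with hW
  have hW0 : 0 ≤ W := by positivity
  have hW1 : W ≤ 1 := by
    refine div_le_one_of_le₀ ?_ (by positivity)
    refine (Finset.sum_le_card_nsmul _ _ 1 fun s _ => ?_).trans (by simp)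
    exact pow_le_one₀ (norm_nonneg _) (norm_avgC_le_one _ _ fun t _ => (norm_eC _).le)
  rcases le_or_gt W (δ / 4) with hle | hlt
  · have : 0 ≤ ∑ q ∈ Icc 1 K,
        ‖avgC (Icc 1 H) (fun h => eC (((h : ℤ) * (q : ℤ) : ℤ) * θ))‖ ^ 2 := by positivity
    linarith
  have hexp := avgC_avgC_avgC_mul_conj (Icc 1 T) S (fun t s => eC (((t : ℤ) * s : ℤ) * θ))
  rw [← hW] at hexp
  have hnorm : δ / 4 < ‖avgC (Icc 1 T) (fun t => avgC (Icc 1 T) (fun t' => avgC S (fun s =>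
      eC (((t : ℤ) * s : ℤ) * θ) * (starRingEnd ℂ) (eC (((t' : ℤ) * s : ℤ) * θ)))))‖ := by
    rw [hexp, Complex.norm_real, Real.norm_eq_abs, abs_of_nonneg hW0]
    exact hlt
  obtain ⟨t₀, -, ht₀⟩ := exists_lt_norm_of_lt_norm_avgC _ _ (by positivity) hnorm
  have hmul : ∀ (t : ℕ) (s : ℤ), eC (((t₀ : ℤ) * s : ℤ) * θ) *
      (starRingEnd ℂ) (eC (((t : ℤ) * s : ℤ) * θ)) = eC ((((t₀ : ℤ) : ℝ) - t) * θ * s) := by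
    intro t s
    rw [conj_eC, ← eC_add]
    push_cast
    ring_nf
  simp_rw [hmul] at ht₀
  have hP := mul_card_le_card_filter (Icc 1 T) _
    (fun t _ => norm_avgC_le_one _ _ fun s _ => (norm_eC _).le)
    (c := δ / 8) (by positivity) (le_trans (by linarith) ht₀.le)
  obtain ⟨q, hq0, hqA, a, ha⟩ := exists_small_denominator hA hD hT t₀ _ (Finset.filter_subset _ _)
    (le_trans (by
      rw [Nat.card_Icc, Nat.add_sub_cancel, div_eq_inv_mul]
      gcongr
      rw [← one_div, le_div_iff₀ (by norm_num)]
      calc 1 / A * 8 = 8 / A := by ring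
        _ ≤ δ := hδ) hP)
    (fun t ht => hS _ (Finset.mem_filter.1 ht).2)
  have hhalf : 1 / 2 ≤ ‖avgC (Icc 1 H) (fun h => eC (((h : ℤ) * (q : ℤ) : ℤ) * θ))‖ := by
    have hH0' : (0 : ℝ) < H := by exact_mod_cast hH0
    have e : avgC (Icc 1 H) (fun h => eC (((h : ℤ) * (q : ℤ) : ℤ) * θ))
        = 1 + avgC (Icc 1 H) (fun h => eC (h * (q * θ - a)) - 1) := by
      have : avgC (Icc 1 H) (fun _ => (1 : ℂ)) = 1 := by
        simp [avgC, hH0.ne']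
      refine Eq.trans ?_ (congrArg
        (· + avgC (Icc 1 H) (fun h => eC (h * (q * θ - a)) - 1)) this)
      unfold avgC
      dsimp only
      rw [← add_div, ← Finset.sum_add_distrib]
      congr 1
      refine Finset.sum_congr rfl fun h _ => ?_
      have hs : (((h : ℤ) * (q : ℤ) : ℤ) : ℝ) * θ
          = h * (q * θ - a) + (((h : ℤ) * a : ℤ) : ℝ) := by
        push_cast
        ring
      rw [hs, eC_add, eC_int]
      ring
    have hβ : (H : ℝ) * |q * θ - a| ≤ 1 / 100 := by
      calc (H : ℝ) * |q * θ - a| ≤ H * (72 * A ^ 6 / (D * T)) := by gcongr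
        _ ≤ 1 / 100 := by
          rw [mul_div_assoc', div_le_div_iff₀ (by positivity) (by norm_num)]
          have h1 : (7200 : ℝ) ≤ A ^ 19 :=
            calc (7200 : ℝ) ≤ (2 ^ 10) ^ 19 := by norm_num
              _ ≤ A ^ 19 := by gcongr
          calc H * (72 * A ^ 6) * 100 = H * (7200 * A ^ 6) := by ring
            _ ≤ H * (A ^ 19 * A ^ 6) := by gcongr
            _ = H * A ^ 25 := by ring
            _ ≤ _ := by linarith
    have hsmall : ‖avgC (Icc 1 H) (fun h => eC (h * (q * θ - a)) - 1)‖ ≤ 1 / 2 := by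
      by_contra! hcon
      obtain ⟨h, hh, hlt⟩ := exists_lt_norm_of_lt_norm_avgC _ _ (by norm_num) hcon
      refine absurd hlt (not_lt.2 ((norm_eC_sub_one_le _).trans ?_))
      rw [abs_mul, Nat.abs_cast]
      have hhH : (h : ℝ) ≤ H := by exact_mod_cast (Finset.mem_Icc.1 hh).2
      have : (h : ℝ) * |q * θ - a| ≤ 1 / 100 :=
        le_trans (by gcongr) hβ
      have hpi := Real.pi_lt_four
      nlinarith [mul_nonneg (Nat.cast_nonneg (α := ℝ) h) (abs_nonneg (q * θ - a))]
    rw [e]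
    have := norm_sub_norm_le (1 : ℂ) (-avgC (Icc 1 H) (fun h => eC (h * (q * θ - a)) - 1))
    rw [norm_one, norm_neg, sub_neg_eq_add] at this
    linarith
  have hqK : q ∈ Icc 1 K := by
    rw [Finset.mem_Icc, hK]
    exact ⟨hq0, Nat.le_floor hqA⟩
  have := Finset.single_le_sum (f := fun q : ℕ =>
    ‖avgC (Icc 1 H) (fun h => eC (((h : ℤ) * (q : ℤ) : ℤ) * θ))‖ ^ 2)
    (fun _ _ => by positivity) hqK
  nlinarith

lemma norm_ext0_le_one {f : ℕ → ℂ} (hf : ∀ n, ‖f n‖ ≤ 1) (k : ℤ) : ‖ext0 f k‖ ≤ 1 := by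
  unfold ext0
  split_ifs
  · exact hf _
  · simp

lemma logAvgC_ofReal (s : Finset ℕ) (x : ℕ → ℝ) :
    logAvgC s (fun n => (x n : ℂ)) = ((logAvgR s x : ℝ) : ℂ) := by
  unfold logAvgC logAvgR
  push_cast
  rfl

lemma log_correlation_eq (N T : ℕ) (S : Finset ℤ) (g : ℤ → ℂ) :
    (logAvgC (Icc 1 N) (fun n => avgC (Icc 1 T) (fun t => avgC (Icc 1 T) (fun t' => avgC S (fun s =>
        g ((n : ℤ) + (t : ℤ) * s) * (starRingEnd ℂ) (g ((n : ℤ) + (t' : ℤ) * s))))))).re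
      = logAvgR (Icc 1 N) (fun n =>
          (∑ s ∈ S, ‖avgC (Icc 1 T) (fun t => g ((n : ℤ) + (t : ℤ) * s))‖ ^ 2) / S.card) := by
  have h : ∀ n : ℕ, _ := fun n =>
    avgC_avgC_avgC_mul_conj (Icc 1 T) S (fun t s => g ((n : ℤ) + (t : ℤ) * s))
  simp_rw [h]
  rw [logAvgC_ofReal, Complex.ofReal_re]

lemma one_add_log_ceil_le {x : ℝ} (hx : 5 ≤ x) :
    1 + Real.log (⌈4 * x⌉₊ : ℕ) ≤ 3 * Real.log x := by
  have hx0 : 0 < x := by linarith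
  have h1 : (⌈4 * x⌉₊ : ℝ) ≤ x ^ 2 := by
    have := (Nat.ceil_lt_add_one (a := 4 * x) (by positivity)).le
    nlinarith
  have h2 : 1 ≤ Real.log x := by
    rw [Real.le_log_iff_exp_le hx0]
    linarith [Real.exp_one_lt_d9]
  have h3 : Real.log (⌈4 * x⌉₊ : ℕ) ≤ Real.log (x ^ 2) := by
    refine Real.log_le_log ?_ h1
    exact_mod_cast Nat.ceil_pos.2 (by positivity)
  rw [Real.log_pow] at h3
  push_cast at h3
  linarith

/-- The inverse theorem with all polynomial losses measured by a single parameter `A`. -/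
lemma exists_large_U1logSq {A D δ : ℝ} {T N H : ℕ} {S : Finset ℤ} {f : ℕ → ℂ}
    (hA : 2 ^ 10 ≤ A) (hδ : 8 / A ≤ δ) (hD : 2 ^ 16 * A ^ 7 ≤ D) (hT : 2 ^ 16 * A ^ 7 ≤ T)
    (hS0 : S.Nonempty) (hSD : ∀ s ∈ S, |(s : ℝ)| ≤ 4 * D)
    (hS : ∀ θ : ℝ, δ / 8 ≤ ‖avgC S (fun s => eC (θ * (s : ℝ)))‖ →
      ∃ q : ℕ, 0 < q ∧ (q : ℝ) ≤ A ∧ dZ ((q : ℝ) * θ) ≤ A / D)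
    (hN : 2 ≤ N) (hlog : Real.log (T * D) * A ^ 25 ≤ Real.log N)
    (hH0 : 0 < H) (hH : H * A ^ 25 ≤ T * D) (hf : ∀ n, ‖f n‖ ≤ 1)
    (hcor : δ ≤ logAvgR (Icc 1 N) (fun n =>
      (∑ s ∈ S, ‖avgC (Icc 1 T) (fun t => ext0 f ((n : ℤ) + (t : ℤ) * s))‖ ^ 2) / S.card)) :
    ∃ q : ℕ, 0 < q ∧ (q : ℝ) ≤ 9 * A ^ 3 ∧ 1 / A ^ 25 ≤ U1logSq N q H f := by
  have hA0 : 0 < A := by linarith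
  have hA1 : 1 ≤ A := by linarith
  have hδ0 : 0 < δ := lt_of_lt_of_le (by positivity) hδ
  have hA7 : 1 ≤ A ^ 7 := one_le_pow₀ hA1
  have hD1 : 5 ≤ D := by linarith
  have hT1 : (1 : ℝ) ≤ T := by linarith
  have hTD : 5 ≤ T * D := by nlinarith
  set g : ℤ → ℂ := ext0 f with hg
  have hg1 : ∀ k, ‖g k‖ ≤ 1 := norm_ext0_le_one hf
  obtain ⟨R, hR⟩ : ∃ R, R = ⌈4 * (T * D)⌉₊ := ⟨_, rfl⟩
  obtain ⟨K, hK⟩ : ∃ K, K = ⌊9 * A ^ 3⌋₊ := ⟨_, rfl⟩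
  have hRle : 4 * (T * D) ≤ R := hR ▸ Nat.le_ceil _
  have hKle : (K : ℝ) ≤ 9 * A ^ 3 := hK ▸ Nat.floor_le (by positivity)
  set Λ : ℝ := ∑ n ∈ Icc 1 N, 1 / (n : ℝ) with hΛ
  set ρ : ℝ := ∑ k ∈ Icc 1 (R : ℤ), recipWeight R k with hρ
  have hlogN : 0 < Real.log N := Real.log_pos (by exact_mod_cast hN)
  have hΛlog : Real.log N ≤ Λ := log_le_sum_one_div (by omega)
  have hΛ0 : 0 < Λ := by linarith
  have hρΛ : ρ * A ^ 25 ≤ 3 * Λ := by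
    have h1 : ρ ≤ 3 * Real.log (T * D) := by
      rw [hρ, sum_recipWeight]
      refine (sum_one_div_le_one_add_log R).trans ?_
      rw [hR]
      exact one_add_log_ceil_le hTD
    have := mul_le_mul_of_nonneg_right h1 (by positivity : 0 ≤ A ^ 25)
    linarith
  have hshift₁ : ∀ s ∈ S, ∀ t ∈ Icc 1 T, |(t : ℤ) * s| ≤ R := by
    intro s hs t ht
    have htT : (t : ℝ) ≤ T := by exact_mod_cast (Finset.mem_Icc.1 ht).2
    have : |((t : ℤ) * s : ℝ)| ≤ R := by
      rw [abs_mul, Int.cast_natCast, Nat.abs_cast]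
      calc (t : ℝ) * |(s : ℝ)| ≤ T * (4 * D) := by
            gcongr
            exact hSD s hs
        _ ≤ R := by linarith
    exact_mod_cast this
  have hshift₂ : ∀ q ∈ Icc 1 K, ∀ h ∈ Icc 1 H, |(h : ℤ) * (q : ℤ)| ≤ R := by
    intro q hq h hh
    have hhH : (h : ℝ) ≤ H := by exact_mod_cast (Finset.mem_Icc.1 hh).2
    have hqK : (q : ℝ) ≤ K := by exact_mod_cast (Finset.mem_Icc.1 hq).2
    have h9 : (9 : ℝ) ≤ A ^ 22 := by
      calc (9 : ℝ) ≤ (2 ^ 10) ^ 22 := by norm_num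
        _ ≤ A ^ 22 := by gcongr
    have : (h : ℝ) * q ≤ R := by
      calc (h : ℝ) * q ≤ H * (9 * A ^ 3) := by
            gcongr
            exact hqK.trans hKle
        _ ≤ H * (A ^ 22 * A ^ 3) := by gcongr
        _ = H * A ^ 25 := by ring
        _ ≤ R := by linarith
    rw [abs_of_nonneg (by positivity)]
    exact_mod_cast this
  have hTne : (Icc 1 T).Nonempty := by
    rw [Finset.nonempty_Icc]
    exact_mod_cast hT1
  have hHne : (Icc 1 H).Nonempty := by
    rw [Finset.nonempty_Icc]
    exact hH0
  set F : ℤ → ℂ := fun k => g k * (√(recipWeight N k) : ℝ) with hF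
  have hF0 : ∀ k, k ∉ Icc 1 (N : ℤ) → F k = 0 := by
    intro k hk
    simp [hF, recipWeight_of_notMem hk]
  have hmem : ∀ k ∈ Icc 1 (N : ℤ), ∀ m : ℤ, |m| ≤ R → k - m ∈ window N R := by
    intro k hk m hm
    rw [abs_le] at hm
    simp only [window, Finset.mem_Icc] at hk ⊢
    omega
  have htransfer := spectral_transfer S T H K (δ / 4) (Icc 1 (N : ℤ)) (window N R) F hF0
    (fun s hs t ht k hk => hmem k hk _ (hshift₁ s hs t ht))
    (fun q hq h hh k hk => hmem k hk _ (hshift₂ q hq h hh))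
    (spectral_inequality hA hδ hD hT hS hH0 hH hK)
  have hFsum : ∑ k ∈ Icc 1 (N : ℤ), ‖F k‖ ^ 2 ≤ Λ := by
    rw [hΛ, ← sum_recipWeight]
    refine Finset.sum_le_sum fun k _ => ?_
    rw [show F k = ((√(recipWeight N k) : ℝ) : ℂ) * g k from mul_comm _ _,
      norm_sqrt_mul_sq (recipWeight_nonneg _ _)]
    exact mul_le_of_le_one_right (recipWeight_nonneg _ _)
      (pow_le_one₀ (norm_nonneg _) (hg1 k))
  have hScard : (0 : ℝ) < S.card := by exact_mod_cast hS0.card_pos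
  have hlower : δ * Λ ≤ 2 * ((∑ s ∈ S, ∑ n ∈ window N R,
      ‖avgC (Icc 1 T) (fun t => F (n + (t : ℤ) * s))‖ ^ 2) / S.card) + 4 * ρ := by
    unfold logAvgR at hcor
    rw [le_div_iff₀ hΛ0] at hcor
    refine hcor.trans ?_
    rw [← sum_window_recipWeight_mul N R (fun n =>
      (∑ s ∈ S, ‖avgC (Icc 1 T) (fun t => g (n + (t : ℤ) * s))‖ ^ 2) / S.card)]
    simp_rw [mul_div_assoc', Finset.mul_sum]
    rw [← Finset.sum_div, Finset.sum_comm, div_le_iff₀ hScard, add_mul,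
      div_mul_cancel₀ _ hScard.ne']
    refine (Finset.sum_le_sum fun s hs => sum_weighted_le_sum_shifted g hg1 N R (Icc 1 T) hTne
      (fun t : ℕ => (t : ℤ) * s) (hshift₁ s hs)).trans (le_of_eq ?_)
    simp_rw [Finset.sum_add_distrib, ← Finset.mul_sum]
    rw [Finset.sum_const, nsmul_eq_mul]
    simp only [hF]
    ring
  by_contra! hcon
  have hupper : ∀ q ∈ Icc 1 K, ∑ n ∈ window N R,
      ‖avgC (Icc 1 H) (fun h => F (n + (h : ℤ) * (q : ℤ)))‖ ^ 2
        ≤ 2 * (Λ / A ^ 25) + 4 * ρ := by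
    intro q hq
    refine (sum_shifted_le_sum_weighted g hg1 N R (Icc 1 H) hHne
      (fun h : ℕ => (h : ℤ) * (q : ℤ)) (hshift₂ q hq)).trans ?_
    gcongr
    have hq' := Finset.mem_Icc.1 hq
    have hlt := hcon q hq'.1 (le_trans (by exact_mod_cast hq'.2) hKle)
    unfold U1logSq logAvgR at hlt
    rw [div_lt_iff₀ hΛ0] at hlt
    rw [sum_window_recipWeight_mul N R (fun n =>
      ‖avgC (Icc 1 H) (fun h : ℕ => g (n + (h : ℤ) * (q : ℤ)))‖ ^ 2)]
    refine le_trans (le_of_eq ?_) (hlt.le.trans (le_of_eq (by ring)))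
    refine Finset.sum_congr rfl fun n _ => ?_
    have : ∀ h : ℕ, g ((n : ℤ) + (h : ℤ) * (q : ℤ)) = f (n + h * q) := by
      intro h
      have e : (n : ℤ) + (h : ℤ) * (q : ℤ) = ((n + h * q : ℕ) : ℤ) := by push_cast; rfl
      rw [hg, e]
      simp only [ext0, Int.natCast_nonneg, if_true, Int.toNat_natCast]
    simp_rw [this]
  have hsum := Finset.sum_le_sum hupper
  rw [Finset.sum_const, Nat.card_Icc, Nat.add_sub_cancel, nsmul_eq_mul] at hsum
  have hρ' : ρ ≤ 3 * (Λ / A ^ 25) := by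
    rw [mul_div_assoc', le_div_iff₀ (by positivity)]
    exact hρΛ
  set μ : ℝ := Λ / A ^ 25 with hμ
  have hμ0 : 0 < μ := by positivity
  have hsum' : (K : ℝ) * (2 * μ + 4 * ρ) ≤ 9 * A ^ 3 * (14 * μ) := by
    have h1 : (K : ℝ) * (2 * μ + 4 * ρ) ≤ K * (14 * μ) := by
      gcongr
      linarith
    exact h1.trans (by gcongr)
  have hΛμ : Λ = μ * A ^ 25 := by
    rw [hμ]
    field_simp
  have hFδ : δ / 4 * ∑ k ∈ Icc 1 (N : ℤ), ‖F k‖ ^ 2 ≤ δ / 4 * Λ := by gcongr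
  have hmain : δ / 2 * Λ ≤ 8 * (9 * A ^ 3 * (14 * μ)) + 12 * μ := by linarith
  have hδA : 8 ≤ δ * A := by rwa [div_le_iff₀ hA0] at hδ
  have h24 : 4 * (μ * A ^ 24) ≤ δ / 2 * Λ := by
    rw [hΛμ]
    have : 0 ≤ μ * A ^ 24 := by positivity
    calc 4 * (μ * A ^ 24) ≤ (δ * A) / 2 * (μ * A ^ 24) := by
          gcongr
          linarith
      _ = _ := by ring
  have hbig : 1020 * (μ * A ^ 3) ≤ μ * A ^ 24 := by
    have : (1020 : ℝ) ≤ A ^ 21 := by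
      calc (1020 : ℝ) ≤ (2 ^ 10) ^ 21 := by norm_num
        _ ≤ A ^ 21 := by gcongr
    calc 1020 * (μ * A ^ 3) ≤ A ^ 21 * (μ * A ^ 3) := by gcongr
      _ = _ := by ring
  have hA3 : μ ≤ μ * A ^ 3 := le_mul_of_one_le_right hμ0.le (one_le_pow₀ hA1)
  linarith

/-- Lemma 2.4 of the paper. -/
theorem inverse_concat_log :
    ∃ δ₀ : ℝ, δ₀ ∈ Set.Ioo (0 : ℝ) 1 ∧ ∃ N₀ : ℕ,
      ∀ (δ L L' D : ℝ) (S : Finset ℤ) (T N H : ℕ) (f : ℕ → ℂ),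
        0 < δ → δ ≤ δ₀ → 1 ≤ L → 1 ≤ L' → 1 ≤ D →
        S.Nonempty → (∀ s ∈ S, |(s : ℝ)| ≤ 4 * D) →
        IsDiophantine L L' D S →
        N₀ ≤ N →
        (L' / δ) ^ (8 * L) ≤ D →
        (L' / δ) ^ (8 * L) ≤ (T : ℝ) →
        Real.log ((T : ℝ) * D) / Real.log N ≤ (δ / L') ^ (50 * L) →
        0 < H → (H : ℝ) ≤ (δ / L') ^ (50 * L) * T * D →
        (∀ n, ‖f n‖ ≤ 1) →
        δ ≤ (logAvgC (Finset.Icc 1 N) (fun n =>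
              avgC (Finset.Icc 1 T) (fun t =>
                avgC (Finset.Icc 1 T) (fun t' =>
                  avgC S (fun s =>
                    ext0 f ((n : ℤ) + (t : ℤ) * s) *
                      (starRingEnd ℂ) (ext0 f ((n : ℤ) + (t' : ℤ) * s))))))).re →
        ∃ q : ℕ, 0 < q ∧ (q : ℝ) ≤ (L' / δ) ^ (8 * L) ∧
          (δ / L') ^ (25 * L) ≤ U1log N q H f := by
  refine ⟨(2 ^ 40)⁻¹, by norm_num, 2, ?_⟩
  intro δ L L' D S T N H f hδ0 hδ hL hL' hD1 hS0 hSD hdio hN hD hT hlog hH0 hH hf hcor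
  have hLne : 0 ≤ L := by linarith
  obtain ⟨Q, hQ⟩ : ∃ Q, Q = L' / δ := ⟨_, rfl⟩
  have hδQ : δ / L' = Q⁻¹ := by rw [hQ, inv_div]
  have hQ40 : 2 ^ 40 ≤ Q := by
    rw [hQ, le_div_iff₀ hδ0]
    have : 2 ^ 40 * δ ≤ 2 ^ 40 * (2 ^ 40)⁻¹ := by gcongr
    norm_num at this ⊢
    linarith
  have hQ0 : 0 < Q := by linarith
  have hpow : ∀ k : ℕ, Q ^ (k * L) = (Q ^ L) ^ k := by
    intro k
    rw [mul_comm, Real.rpow_mul_natCast hQ0.le]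
  have hpow' : ∀ k : ℕ, (Q⁻¹) ^ (k * L) = ((Q ^ L) ^ k)⁻¹ := by
    intro k
    rw [Real.inv_rpow hQ0.le, hpow]
  have h8 := hpow 8
  have h25 := hpow' 25
  have h50 := hpow' 50
  push_cast at h8 h25 h50
  rw [← hQ, h8] at hD hT
  rw [hδQ, h50] at hlog hH
  rw [← hQ, hδQ, h8, h25]
  obtain ⟨B, hB⟩ : ∃ B, B = Q ^ L := ⟨_, rfl⟩
  obtain ⟨E, hE⟩ : ∃ E, E = (8 : ℝ) ^ L := ⟨_, rfl⟩
  rw [← hB] at hD hT hlog hH ⊢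
  have hE1 : 1 ≤ E := hE ▸ Real.one_le_rpow (by norm_num) hLne
  have hEB : 2 ^ 16 * E ^ 7 ≤ B := by
    have h1 : (2 : ℝ) ^ 16 ≤ (2 ^ 16 : ℝ) ^ L := Real.self_le_rpow_of_one_le (by norm_num) hL
    have h2 : E ^ 7 = ((8 : ℝ) ^ 7) ^ L := by
      rw [hE, ← Real.rpow_mul_natCast (by norm_num), mul_comm, Real.rpow_natCast_mul (by norm_num)]
    calc 2 ^ 16 * E ^ 7 ≤ (2 ^ 16 : ℝ) ^ L * ((8 : ℝ) ^ 7) ^ L := by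
          rw [h2]
          gcongr
      _ = (2 ^ 16 * 8 ^ 7 : ℝ) ^ L := (Real.mul_rpow (by norm_num) (by norm_num)).symm
      _ ≤ B := by
          rw [hB]
          exact Real.rpow_le_rpow (by norm_num) (le_trans (by norm_num) hQ40) hLne
  have hEB' : E ≤ B := by
    have : E ≤ E ^ 7 := le_self_pow₀ hE1 (by norm_num)
    linarith
  have hB1 : 1 ≤ B := hE1.trans hEB'
  have hB0 : 0 < B := by linarith
  obtain ⟨A, hA⟩ : ∃ A, A = E * B := ⟨_, rfl⟩
  have hA' : A = (8 * Q) ^ L := by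
    rw [hA, hE, hB, Real.mul_rpow (by norm_num) hQ0.le]
  have hAQ : 8 * Q ≤ A := by
    rw [hA']
    exact Real.self_le_rpow_of_one_le (by linarith) hL
  have hA10 : 2 ^ 10 ≤ A := by linarith
  have hA0 : 0 < A := by linarith
  have hA7 : 2 ^ 16 * A ^ 7 ≤ B ^ 8 := by
    calc 2 ^ 16 * A ^ 7 = (2 ^ 16 * E ^ 7) * B ^ 7 := by rw [hA]; ring
      _ ≤ B * B ^ 7 := by gcongr
      _ = B ^ 8 := by ring
  have hA25 : A ^ 25 ≤ B ^ 50 := by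
    calc A ^ 25 ≤ (B * B) ^ 25 := by
          rw [hA]
          gcongr
      _ = B ^ 50 := by ring
  have hδA : 8 / A ≤ δ := by
    rw [div_le_iff₀ hA0]
    have : L' = Q * δ := by
      rw [hQ]
      field_simp
    nlinarith
  have hlogN : 0 < Real.log N := Real.log_pos (by exact_mod_cast hN)
  have hT1 : (1 : ℝ) ≤ T := (one_le_pow₀ hB1).trans hT
  have hlogTD : 0 ≤ Real.log (T * D) := Real.log_nonneg (by nlinarith)
  rw [log_correlation_eq] at hcor
  obtain ⟨q, hq0, hqA, hq⟩ := exists_large_U1logSq hA10 hδA (hA7.trans hD) (hA7.trans hT) hS0 hSD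
    (by
      intro θ hθ
      have := hdio (δ / 8) θ (by positivity) (by linarith) hθ
      rwa [div_div_eq_mul_div, mul_comm L', mul_div_assoc, ← hQ, ← hA'] at this)
    hN (by
      rw [div_le_iff₀ hlogN, inv_mul_eq_div, le_div_iff₀ (by positivity)] at hlog
      refine le_trans ?_ hlog
      gcongr) hH0 (by
      rw [mul_assoc, inv_mul_eq_div, le_div_iff₀ (by positivity)] at hH
      refine le_trans ?_ hH
      gcongr) hf hcor
  refine ⟨q, hq0, hqA.trans (le_trans ?_ hA7), ?_⟩
  · have : A ^ 3 ≤ A ^ 7 := pow_le_pow_right₀ (by linarith) (by norm_num)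
    nlinarith [pow_pos hA0 3]
  · refine Real.le_sqrt_of_sq_le (le_trans ?_ hq)
    rw [inv_pow, ← pow_mul, ← one_div]
    exact one_div_le_one_div_of_le (by positivity) hA25
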